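/- arXiv:1909.00019 — 2 statements merged into one kernel-verified Lean document; each statement's English description precedes it below -/
import Mathlib

section
/- Let S_k be the star graph with center vertex c and leaves u_1, ..., u_k (i.e., the complete bipartite graph K_{1,k}), where k ≥ 1. Then the number of words of minimal length ℓ(S_k) = 2k that word-represent S_k equals 2 · k!. Moreover, every such minimal length word-representant is of the form u_k u_1 u_2 ⋯ u_{k−1} c u_{k−1} u_{k−2} ⋯ u_1 or u_1 u_2 ⋯ u_{k−1} c u_{k−1} u_{k−2} ⋯ u_1 u_k, for some labeling of the leaves as u_1, ..., u_k. -/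
variable {V : Type*}

/-- The restriction of a word `w` to the letters `x` and `y`. -/
def restrictWord [DecidableEq V] (w : List V) (x y : V) : List V :=
  w.filter fun z => decide (z = x ∨ z = y)

/-- `x` and `y` alternate in `w`: the restriction of `w` to `{x, y}` has no two
consecutive equal letters. -/
def Alternates [DecidableEq V] (w : List V) (x y : V) : Prop :=
  (restrictWord w x y).Chain' (· ≠ ·)

/-- `w` word-represents the simple graph `G`: every vertex occurs in `w`, and two distinct
vertices are adjacent iff they alternate in `w`. -/
def Represents [DecidableEq V] (G : SimpleGraph V) (w : List V) : Prop :=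
  (∀ v : V, v ∈ w) ∧ ∀ x y : V, x ≠ y → (G.Adj x y ↔ Alternates w x y)

/-- `ℓ(G)`: the minimal length of a word-representant of `G`. -/
noncomputable def minRepLength [DecidableEq V] (G : SimpleGraph V) : ℕ :=
  sInf {n | ∃ w : List V, Represents G w ∧ w.length = n}

/-- The star graph `S_k = K_{1,k}` on vertex set `Fin (k+1)`, with center `0` and
leaves the `k` nonzero vertices. -/
def starGraph (k : ℕ) : SimpleGraph (Fin (k + 1)) :=
  SimpleGraph.fromRel fun i _ => i = 0

theorem last_lt {k : ℕ} (hk : 1 ≤ k) : k - 1 < k := by omega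

theorem init_le (k : ℕ) : k - 1 ≤ k := by omega

section helpers
variable {α : Type*} [DecidableEq α]

theorem rW_append (a b : List α) (x y : α) :
    restrictWord (a ++ b) x y = restrictWord a x y ++ restrictWord b x y := by
  simp [restrictWord]

theorem rW_reverse (a : List α) (x y : α) :
    restrictWord a.reverse x y = (restrictWord a x y).reverse := by
  simp [restrictWord, List.filter_reverse]

theorem rW_comm (a : List α) (x y : α) : restrictWord a x y = restrictWord a y x := by
  simp [restrictWord, or_comm]

theorem rW_cons (c : α) (a : List α) (x y : α) :
    restrictWord (c :: a) x y = restrictWord [c] x y ++ restrictWord a x y := by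
  simpa using rW_append [c] a x y

theorem rW_left (x y : α) : restrictWord [x] x y = [x] := by simp [restrictWord]
theorem rW_right (x y : α) : restrictWord [y] x y = [y] := by simp [restrictWord]
theorem rW_other (x y z : α) (h : z ≠ x) (h' : z ≠ y) : restrictWord [z] x y = [] := by
  simp [restrictWord, h, h']

theorem rW_notmem (a : List α) (x y : α) (h : y ∉ a) :
    restrictWord a x y = List.replicate (a.count x) x := by
  rw [← List.filter_eq]
  unfold restrictWord
  apply List.filter_congr
  intro z hz
  have : z ≠ y := by rintro rfl; exact h hz
  simp [this, eq_comm]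

theorem alt_reverse (w : List α) (x y : α) : Alternates w.reverse x y ↔ Alternates w x y := by
  unfold Alternates
  rw [rW_reverse]
  change List.IsChain _ _ ↔ List.IsChain _ _
  rw [List.isChain_reverse]
  have : (fun a b : α => b ≠ a) = (· ≠ ·) := by
    funext a b; simp [eq_comm]
  first
  | rw [this]
  | (constructor <;> intro h <;> exact h.imp (fun a b hab => Ne.symm hab))

theorem rep_reverse (G : SimpleGraph α) (w : List α) :
    Represents G w.reverse ↔ Represents G w := by
  simp [Represents, alt_reverse]

theorem alt_comm (w : List α) (x y : α) : Alternates w x y ↔ Alternates w y x := by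
  unfold Alternates; rw [rW_comm]

theorem alt_of_count (w : List α) (x y : α) (hx : w.count x ≤ 1) (hy : w.count y ≤ 1) :
    Alternates w x y := by
  have : (restrictWord w x y).Nodup := by
    rw [List.nodup_iff_count_le_one]
    intro a
    by_cases ha : a = x ∨ a = y
    · refine le_trans (List.Sublist.count_le a List.filter_sublist) ?_
      rcases ha with rfl | rfl <;> assumption
    · rw [List.count_eq_zero_of_not_mem]
      · simp
      · simp [restrictWord]; intro _; simpa using ha
  exact List.Pairwise.isChain this

/-- Two duplicate-free lists with the same letters such that no pair alternates in
`Q ++ R.reverse` are equal. -/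
theorem eq_of_pairs (Q : List α) : ∀ R : List α, Q.Nodup → R.Nodup → (∀ z, z ∈ Q ↔ z ∈ R) →
    (∀ x ∈ Q, ∀ y ∈ Q, x ≠ y → ¬ Alternates (Q ++ R.reverse) x y) → Q = R := by
  induction Q with
  | nil =>
    intro R _ _ h _
    symm
    rw [List.eq_nil_iff_forall_not_mem]
    intro a ha
    simpa using (h a).2 ha
  | cons x Q ih =>
    intro R hQ hR hm ha
    obtain ⟨P, T, rfl⟩ := List.append_of_mem ((hm x).1 (by simp))
    have hP : P = [] := by
      rw [List.eq_nil_iff_forall_not_mem]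
      intro y hy
      have hyx : y ≠ x := by
        rintro rfl
        simp [List.nodup_append] at hR
        grind
      have hyQ : y ∈ Q := by
        have := (hm y).2 (by simp [hy])
        simpa [hyx] using this
      apply ha x (by simp) y (by simp [hyQ]) hyx.symm
      have hxQ : x ∉ Q := by simp at hQ; exact hQ.1
      have hxP : x ∉ P := by simp [List.nodup_append] at hR; grind
      have hxT : x ∉ T := by simp [List.nodup_append] at hR; grind
      have hyT : y ∉ T := by simp [List.nodup_append] at hR; grind
      have c1 : Q.count y = 1 := List.count_eq_one_of_mem (by simp at hQ; exact hQ.2) hyQ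
      have c2 : P.count y = 1 := List.count_eq_one_of_mem (by
        simp [List.nodup_append] at hR; grind) hy
      have c3 : T.count y = 0 := List.count_eq_zero_of_not_mem hyT
      unfold Alternates
      rw [rW_append, rW_reverse, rW_append, rW_cons x Q, rW_cons x T, rW_left,
        rW_comm Q, rW_notmem Q y x hxQ, rW_comm P, rW_notmem P y x hxP,
        rW_comm T, rW_notmem T y x hxT, c1, c2, c3]
      change List.IsChain _ _
      simp [hyx, hyx.symm]
    subst hP
    simp only [List.nil_append] at *
    congr 1
    simp only [List.nodup_cons] at hQ hR
    refine ih T hQ.2 hR.2 ?_ ?_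
    · intro z
      have := hm z
      by_cases hz : z = x
      · subst hz; simp [hQ.1, hR.1]
      · simpa [hz] using this
    · intro y hy z hz hyz h
      apply ha y (by simp [hy]) z (by simp [hz]) hyz
      have hxy : x ≠ y := by rintro rfl; exact hQ.1 hy
      have hxz : x ≠ z := by rintro rfl; exact hQ.1 hz
      unfold Alternates at h ⊢
      rw [rW_append, rW_reverse] at h ⊢
      rw [rW_cons x Q, rW_cons x T, rW_other _ _ _ hxy hxz]
      simpa using h

theorem count_two_split (a b : List α) (x c : α) (hxc : x ≠ c) (ha : c ∉ a) (hb : c ∉ b)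
    (h2 : (a ++ c :: b).count x = 2) (halt : Alternates (a ++ c :: b) x c) :
    a.count x = 1 ∧ b.count x = 1 := by
  unfold Alternates at halt
  rw [rW_append, rW_cons, rW_right, rW_notmem _ _ _ ha, rW_notmem _ _ _ hb] at halt
  have h3 : a.count x + b.count x = 2 := by
    simpa [List.count_cons, hxc.symm] using h2
  change List.IsChain _ _ at halt
  have : a.count x = 0 ∨ a.count x = 1 ∨ a.count x = 2 := by omega
  rcases this with h | h | h
  · have h' : b.count x = 2 := by omega
    rw [h, h'] at halt
    simp [List.replicate] at halt
  · omega
  · have h' : b.count x = 0 := by omega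
    rw [h, h'] at halt
    simp [List.replicate] at halt

end helpers

theorem star_adj (k : ℕ) (x y : Fin (k + 1)) :
    (starGraph k).Adj x y ↔ x ≠ y ∧ (x = 0 ∨ y = 0) := by
  simp [starGraph]

/-- The canonical word. -/
def starWord {k : ℕ} (s : Fin (k + 1)) (A : List (Fin (k + 1))) : List (Fin (k + 1)) :=
  s :: A ++ 0 :: A.reverse

theorem starWord_rep {k : ℕ} (s : Fin (k + 1)) (A : List (Fin (k + 1))) (hs : s ≠ 0)
    (hA : A.Nodup) (h0 : (0 : Fin (k + 1)) ∉ A) (hsA : s ∉ A)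
    (hall : ∀ v, v = 0 ∨ v = s ∨ v ∈ A) : Represents (starGraph k) (starWord s A) := by
  have key0 : ∀ y, y ≠ 0 → Alternates (starWord s A) 0 y := by
    intro y hy
    rw [alt_comm]
    unfold Alternates starWord
    rw [rW_append, rW_cons s, rW_cons 0, rW_reverse, rW_right, rW_notmem A _ _ h0]
    change List.IsChain _ _
    rcases hall y with h | h | h
    · exact absurd h hy
    · subst h
      rw [rW_left, List.count_eq_zero_of_not_mem hsA]
      simp [hs]
    · rw [List.count_eq_one_of_mem hA h, rW_other]
      · simp [hy, hy.symm]
      · rintro rfl; exact hsA h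
      · exact hs
  have keyA : ∀ x y, x ≠ 0 → y ≠ 0 → x ≠ y → x ∈ A → ¬ Alternates (starWord s A) x y := by
    intro x y hx hy hxy hxA halt
    unfold Alternates starWord at halt
    rw [rW_append, rW_cons 0, rW_cons s, rW_other _ _ _ hx.symm hy.symm, rW_reverse] at halt
    change List.IsChain _ _ at halt
    have hne : restrictWord A x y ≠ [] := by
      apply List.ne_nil_of_mem (a := x)
      simp [restrictWord, hxA]
    obtain ⟨L, z, hL⟩ := List.eq_nil_or_concat (restrictWord A x y) |>.resolve_left hne
    rw [hL] at halt
    simp only [List.concat_eq_append, List.reverse_append, List.reverse_cons, List.reverse_nil, List.nil_append,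
      List.append_assoc, List.singleton_append, List.cons_append] at halt
    rw [← List.append_assoc, List.isChain_append] at halt
    simp at halt
  refine ⟨?_, ?_⟩
  · intro v
    rcases hall v with h | h | h <;> simp [starWord, h]
  · intro x y hxy
    rw [star_adj]
    constructor
    · rintro ⟨_, h | h⟩
      · subst h; exact key0 y hxy.symm
      · subst h; rw [alt_comm]; exact key0 x hxy
    · intro h
      refine ⟨hxy, ?_⟩
      by_contra! hc
      rcases hall x with h1 | h1 | h1
      · exact hc.1 h1
      · rcases hall y with h2 | h2 | h2
        · exact hc.2 h2
        · exact hxy (h1.trans h2.symm)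
        · rw [alt_comm] at h
          exact keyA y x hc.2 hc.1 hxy.symm h2 h
      · exact keyA x y hc.1 hc.2 hxy h1 h

theorem length_eq_sum {k : ℕ} (w : List (Fin (k + 1))) :
    w.length = w.count 0 + ∑ i : Fin k, w.count i.succ := by
  rw [← Fin.sum_univ_succ (f := fun v => w.count v)]
  have := Multiset.sum_count_eq_card (s := (Finset.univ : Finset (Fin (k + 1))))
    (m := (w : Multiset (Fin (k + 1)))) (by simp)
  simpa using this.symm

theorem rep_lower {k : ℕ} (w : List (Fin (k + 1))) (h : Represents (starGraph k) w) :
    2 * k ≤ w.length ∧ (w.length = 2 * k → w.count 0 = 1 ∧ ∃ s : Fin (k + 1), s ≠ 0 ∧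
      w.count s = 1 ∧ ∀ x, x ≠ 0 → x ≠ s → w.count x = 2) := by
  have hpos : ∀ v, 1 ≤ w.count v := fun v => List.count_pos_iff.2 (h.1 v)
  have hsum := length_eq_sum w
  have h0 := hpos 0
  by_cases hex : ∃ i : Fin k, w.count i.succ = 1
  · obtain ⟨i, hi⟩ := hex
    have hge : ∀ j ∈ Finset.univ.erase i, 2 ≤ w.count (Fin.succ j) := by
      intro j hj
      have hji : j ≠ i := Finset.ne_of_mem_erase hj
      by_contra hlt
      have hj1 : w.count j.succ ≤ 1 := by omega
      have hne : j.succ ≠ i.succ := by simpa using hji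
      have := (h.2 _ _ hne).2 (alt_of_count w _ _ hj1 hi.le)
      rw [star_adj] at this
      simp [Fin.succ_ne_zero] at this
    rw [← Finset.add_sum_erase _ _ (Finset.mem_univ i), hi] at hsum
    have hcard : (Finset.univ.erase i).card = k - 1 := by simp
    have hle := Finset.card_nsmul_le_sum _ _ _ hge
    rw [hcard, smul_eq_mul] at hle
    have hk : 1 ≤ k := by have := i.2; omega
    refine ⟨by omega, fun hl => ⟨by omega, i.succ, Fin.succ_ne_zero _, hi, ?_⟩⟩
    have hS : ∑ j ∈ Finset.univ.erase i, 2 = ∑ j ∈ Finset.univ.erase i, w.count (Fin.succ j) := by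
      rw [Finset.sum_const, hcard, smul_eq_mul]; omega
    rw [Finset.sum_eq_sum_iff_of_le hge] at hS
    intro x hx hxi
    obtain ⟨j, rfl⟩ := Fin.exists_succ_eq.2 hx
    exact (hS j (by simp; rintro rfl; exact hxi rfl)).symm
  · push Not at hex
    have hge : ∀ j ∈ (Finset.univ : Finset (Fin k)), 2 ≤ w.count (Fin.succ j) := by
      intro j _
      have := hex j
      have := hpos j.succ
      omega
    have hle := Finset.card_nsmul_le_sum _ _ _ hge
    simp at hle
    constructor
    · omega
    · intro; omega

theorem rep_struct_aux {k : ℕ} (a b : List (Fin (k + 1))) (s : Fin (k + 1))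
    (h : Represents (starGraph k) (a ++ 0 :: b)) (ha : 0 ∉ a) (hb : 0 ∉ b) (hs : s ≠ 0)
    (hsa : s ∈ a) (hs1 : (a ++ 0 :: b).count s = 1)
    (h2 : ∀ x, x ≠ 0 → x ≠ s → (a ++ 0 :: b).count x = 2) :
    ∃ A : List (Fin (k + 1)), (s :: A).Nodup ∧ 0 ∉ A ∧ (∀ v, v = 0 ∨ v = s ∨ v ∈ A) ∧
      a ++ 0 :: b = starWord s A := by
  have hsplit : ∀ x, x ≠ 0 → x ≠ s → a.count x = 1 ∧ b.count x = 1 := fun x hx hxs =>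
    count_two_split a b x 0 hx ha hb (h2 x hx hxs)
      ((h.2 x 0 hx).1 ((star_adj k _ _).2 ⟨hx, Or.inr rfl⟩))
  have hsc : a.count s = 1 ∧ b.count s = 0 := by
    have h1 : a.count s + b.count s = 1 := by
      simpa [List.count_cons, hs.symm] using hs1
    have := List.count_pos_iff.2 hsa
    omega
  have hsb : s ∉ b := List.count_eq_zero.1 hsc.2
  have hand : a.Nodup := by
    rw [List.nodup_iff_count_le_one]
    intro x
    by_cases hx : x = 0
    · subst hx; rw [List.count_eq_zero_of_not_mem ha]; simp
    by_cases hxs : x = s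
    · subst hxs; omega
    · exact (hsplit x hx hxs).1.le
  have hbnd : b.Nodup := by
    rw [List.nodup_iff_count_le_one]
    intro x
    by_cases hx : x = 0
    · subst hx; rw [List.count_eq_zero_of_not_mem hb]; simp
    by_cases hxs : x = s
    · subst hxs; omega
    · exact (hsplit x hx hxs).2.le
  obtain ⟨P, Q, rfl⟩ := List.append_of_mem hsa
  have hnon : ∀ x y, x ≠ 0 → y ≠ 0 → x ≠ y → ¬ Alternates (P ++ s :: Q ++ 0 :: b) x y := by
    intro x y hx hy hxy halt
    have := (h.2 x y hxy).2 halt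
    rw [star_adj] at this
    simp [hx, hy] at this
  have hsP : s ∉ P := by simp [List.nodup_append] at hand; grind
  have hsQ : s ∉ Q := by simp [List.nodup_append] at hand; grind
  have hP : P = [] := by
    rw [List.eq_nil_iff_forall_not_mem]
    intro x hx
    have hx0 : x ≠ 0 := by rintro rfl; exact ha (by simp [hx])
    have hxs : x ≠ s := by rintro rfl; exact hsP hx
    apply hnon x s hx0 hs hxs
    have hxQ : x ∉ Q := by simp [List.nodup_append] at hand; grind
    have c1 : P.count x = 1 := List.count_eq_one_of_mem (by
      simp [List.nodup_append] at hand; grind) hx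
    unfold Alternates
    rw [rW_append, rW_append, rW_cons s, rW_cons 0, rW_right,
      rW_other _ _ _ hx0.symm hs.symm, rW_notmem P _ _ hsP, rW_notmem Q _ _ hsQ,
      rW_notmem b _ _ hsb, c1, List.count_eq_zero_of_not_mem hxQ, (hsplit x hx0 hxs).2]
    change List.IsChain _ _
    simp [hxs, hxs.symm]
  subst hP
  simp only [List.nil_append] at *
  have h0Q : 0 ∉ Q := fun h => ha (by simp [h])
  have hQ : ∀ x, x ≠ 0 → x ≠ s → x ∈ Q := by
    intro x hx hxs
    have : x ∈ s :: Q := List.count_pos_iff.1 (by have := (hsplit x hx hxs).1; omega)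
    simpa [hxs] using this
  refine ⟨Q, hand, h0Q, ?_, ?_⟩
  · intro v
    have := hQ v
    tauto
  · have hbQ : Q = b.reverse := by
      apply eq_of_pairs Q b.reverse (List.nodup_cons.1 hand).2 (by simpa using hbnd)
      · intro z
        by_cases hz : z = 0
        · subst hz; simp [h0Q, hb]
        by_cases hzs : z = s
        · subst hzs; simp [hsQ, hsb]
        · have : z ∈ b := List.count_pos_iff.1 (by have := (hsplit z hz hzs).2; omega)
          simp [this, hQ z hz hzs]
      · intro x hx y hy hxy halt
        have hx0 : x ≠ 0 := by rintro rfl; exact h0Q hx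
        have hy0 : y ≠ 0 := by rintro rfl; exact h0Q hy
        have hxs : s ≠ x := by rintro rfl; exact hsQ hx
        have hys : s ≠ y := by rintro rfl; exact hsQ hy
        apply hnon x y hx0 hy0 hxy
        unfold Alternates at halt ⊢
        rw [rW_append, List.reverse_reverse] at halt
        rw [rW_append, rW_cons s, rW_cons 0, rW_other _ _ _ hxs hys,
          rW_other _ _ _ hx0.symm hy0.symm]
        simpa using halt
    unfold starWord
    rw [hbQ]
    simp

theorem rep_struct {k : ℕ} (w : List (Fin (k + 1))) (h : Represents (starGraph k) w)
    (hl : w.length = 2 * k) : ∃ (s : Fin (k + 1)) (A : List (Fin (k + 1))), s ≠ 0 ∧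
      (s :: A).Nodup ∧ 0 ∉ A ∧ (∀ v, v = 0 ∨ v = s ∨ v ∈ A) ∧
      (w = starWord s A ∨ w = (starWord s A).reverse) := by
  obtain ⟨h0, s, hs, hs1, h2⟩ := (rep_lower w h).2 hl
  obtain ⟨a, b, rfl⟩ := List.append_of_mem (h.1 0)
  have hab : a.count 0 + b.count 0 = 0 := by
    simp [List.count_cons] at h0 ⊢; omega
  have ha : 0 ∉ a := List.count_eq_zero.1 (by omega)
  have hb : 0 ∉ b := List.count_eq_zero.1 (by omega)
  have hmem : s ∈ a ∨ s ∈ b := by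
    have := h.1 s
    simpa [hs] using this
  rcases hmem with hm | hm
  · obtain ⟨A, h1, h2, h3, h4⟩ := rep_struct_aux a b s h ha hb hs hm hs1 h2
    exact ⟨s, A, hs, h1, h2, h3, Or.inl h4⟩
  · have e : (a ++ 0 :: b).reverse = b.reverse ++ 0 :: a.reverse := by simp
    obtain ⟨A, h1, h2, h3, h4⟩ := rep_struct_aux b.reverse a.reverse s
      (by rw [← e, rep_reverse]; exact h) (by simpa using hb) (by simpa using ha) hs
      (by simpa using hm) (by rw [← e, List.count_reverse]; exact hs1)
      (by intro x; rw [← e, List.count_reverse]; exact h2 x)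
    refine ⟨s, A, hs, h1, h2, h3, Or.inr ?_⟩
    rw [← h4, ← e, List.reverse_reverse]

/-- Initial leaves of a labeling. -/
def initList {k : ℕ} (u : Fin k → Fin (k + 1)) : List (Fin (k + 1)) :=
  List.ofFn fun i : Fin (k - 1) => u (Fin.castLE (init_le k) i)

theorem starWord_length {k : ℕ} (s : Fin (k + 1)) (A : List (Fin (k + 1))) :
    (starWord s A).length = 2 * A.length + 2 := by
  simp [starWord]; omega

theorem rep_labeling {k : ℕ} (hk : 1 ≤ k) (w : List (Fin (k + 1)))
    (h : Represents (starGraph k) w)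
    (hl : w.length = 2 * k) : ∃ u : Fin k → Fin (k + 1), Function.Injective u ∧ (∀ i, u i ≠ 0) ∧
      (w = starWord (u ⟨k - 1, last_lt hk⟩) (initList u) ∨
       w = (starWord (u ⟨k - 1, last_lt hk⟩) (initList u)).reverse) := by
  obtain ⟨s, A, hs, hnd, h0, _, hw⟩ := rep_struct w h hl
  have hlen : A.length = k - 1 := by
    have : w.length = 2 * A.length + 2 := by
      rcases hw with rfl | rfl <;> simp [starWord_length]
    omega
  have hlen' : (A ++ [s]).length = k := by simp [hlen]; omega
  have hnd' : (A ++ [s]).Nodup := by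
    have : (A ++ [s]).Perm (s :: A) := by simp
    exact this.nodup_iff.2 hnd
  refine ⟨fun i => (A ++ [s])[i.1]'(by rw [hlen']; exact i.2), ?_, ?_, ?_⟩
  · intro i j hij
    have := (List.Nodup.getElem_inj_iff hnd').1 hij
    exact Fin.ext this
  · intro i hi
    have : (A ++ [s])[i.1]'(by rw [hlen']; exact i.2) ∈ A ++ [s] := List.getElem_mem _
    simp only [hi] at this
    simp [h0, hs.symm] at this
  · have e1 : (A ++ [s])[k - 1]'(by omega) = s := by
      simp [← hlen]
    have e2 : initList (fun i : Fin k => (A ++ [s])[i.1]'(by rw [hlen']; exact i.2)) = A := by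
      unfold initList
      apply List.ext_getElem
      · simp [hlen]
      · intro i h1 h2
        simp [List.getElem_append_left h2]
    simp only [e1, e2]
    exact hw

theorem labeling_rep {k : ℕ} (hk : 1 ≤ k) (u : Fin k → Fin (k + 1)) (hu : Function.Injective u)
    (hu0 : ∀ i, u i ≠ 0) :
    Represents (starGraph k) (starWord (u ⟨k - 1, last_lt hk⟩) (initList u)) ∧
      (starWord (u ⟨k - 1, last_lt hk⟩) (initList u)).length = 2 * k := by
  have hlen : (initList u).length = k - 1 := by simp [initList]
  constructor
  · apply starWord_rep
    · exact hu0 _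
    · unfold initList
      rw [List.nodup_ofFn]
      intro i j hij
      have := hu hij
      simpa using this
    · simp [initList, List.mem_ofFn, hu0]
    · simp only [initList, List.mem_ofFn, not_exists]
      intro i hi
      have := congrArg Fin.val (hu hi)
      have := i.2
      simp at *
      omega
    · intro v
      by_cases hv : v = 0
      · exact Or.inl hv
      right
      have hbij : Function.Bijective (fun i => (u i).pred (hu0 i)) := by
        rw [← Finite.injective_iff_bijective]
        intro i j hij
        exact hu (by simpa using hij)
      obtain ⟨i, hi⟩ := hbij.2 (v.pred hv)
      have hi' : u i = v := by simpa using hi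
      by_cases hik : i.1 = k - 1
      · left; rw [← hi']; congr 1; exact Fin.ext hik
      · right
        simp only [initList, List.mem_ofFn]
        exact ⟨⟨i.1, by have := i.2; omega⟩, hi'⟩
  · rw [starWord_length, hlen]; omega

/-- The enumeration of the minimal words. -/
def starEnum {k : ℕ} (hk : 1 ≤ k) (p : Bool × Equiv.Perm (Fin k)) : List (Fin (k + 1)) :=
  let u : Fin k → Fin (k + 1) := fun i => (p.2 i).succ
  if p.1 then starWord (u ⟨k - 1, last_lt hk⟩) (initList u)
  else (starWord (u ⟨k - 1, last_lt hk⟩) (initList u)).reverse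

theorem starWord_inj {k : ℕ} (s t : Fin (k + 1)) (A B : List (Fin (k + 1)))
    (hl : A.length = B.length) (h : starWord s A = starWord t B) : s = t ∧ A = B := by
  unfold starWord at h
  have := (List.append_inj h (by simp [hl])).1
  simpa using this

theorem labeling_ext {k : ℕ} (hk : 1 ≤ k) (u v : Fin k → Fin (k + 1))
    (h1 : u ⟨k - 1, last_lt hk⟩ = v ⟨k - 1, last_lt hk⟩) (h2 : initList u = initList v) : u = v := by
  funext i
  by_cases hik : i.1 = k - 1
  · have : i = ⟨k - 1, last_lt hk⟩ := Fin.ext hik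
    rw [this, h1]
  · unfold initList at h2
    have := congrFun (List.ofFn_injective h2) ⟨i.1, by have := i.2; omega⟩
    exact this

theorem starWord_ne {k : ℕ} (s t : Fin (k + 1)) (A B : List (Fin (k + 1)))
    (hl : A.length = B.length) (hs : s ≠ 0) (hA : 0 ∉ A) :
    starWord s A ≠ (starWord t B).reverse := by
  intro h
  have e : (starWord t B).reverse = B ++ ([0] ++ (B.reverse ++ [t])) := by simp [starWord]
  rw [e] at h
  have h' : (s :: A) ++ ([0] ++ A.reverse) = B ++ ([0] ++ (B.reverse ++ [t])) := by
    simpa [starWord] using h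
  have h1 := congrArg (fun l => l[B.length]?) h'
  rw [List.getElem?_append_left (by simp [hl])] at h1
  simp only [le_refl, List.getElem?_append_right, Nat.sub_self] at h1
  have hm := List.mem_of_getElem? h1
  simp [hs.symm, hA] at hm

theorem starEnum_injective {k : ℕ} (hk : 1 ≤ k) : Function.Injective (starEnum hk) := by
  have aux : ∀ σ τ : Equiv.Perm (Fin k),
      starWord ((σ ⟨k - 1, last_lt hk⟩).succ) (initList fun i => (σ i).succ) =
      starWord ((τ ⟨k - 1, last_lt hk⟩).succ) (initList fun i => (τ i).succ) → σ = τ := by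
    intro σ τ h
    obtain ⟨h1, h2⟩ := starWord_inj _ _ _ _ (by simp [initList]) h
    have := labeling_ext hk (fun i => (σ i).succ) (fun i => (τ i).succ) h1 h2
    ext i
    have := congrFun this i
    simpa using congrArg Fin.val this
  have aux2 : ∀ σ τ : Equiv.Perm (Fin k),
      starWord ((σ ⟨k - 1, last_lt hk⟩).succ) (initList fun i => (σ i).succ) ≠
      (starWord ((τ ⟨k - 1, last_lt hk⟩).succ) (initList fun i => (τ i).succ)).reverse := by
    intro σ τ
    apply starWord_ne
    · simp [initList]
    · exact Fin.succ_ne_zero _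
    · simp [initList, List.mem_ofFn, Fin.succ_ne_zero]
  rintro ⟨b, σ⟩ ⟨c, τ⟩ h
  cases b <;> cases c <;> simp only [starEnum, if_true, Bool.false_eq_true, if_false] at h
  · rw [aux σ τ (List.reverse_injective h)]
  · exact absurd h.symm (aux2 _ _)
  · exact absurd h (aux2 _ _)
  · rw [aux σ τ h]

theorem starEnum_range {k : ℕ} (hk : 1 ≤ k) :
    {w : List (Fin (k + 1)) | Represents (starGraph k) w ∧ w.length = 2 * k} =
      Set.range (starEnum hk) := by
  ext w
  constructor
  · rintro ⟨h, hl⟩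
    obtain ⟨u, hu, hu0, hw⟩ := rep_labeling hk w h hl
    have hbij : Function.Bijective (fun i => (u i).pred (hu0 i)) := by
      rw [← Finite.injective_iff_bijective]
      intro i j hij
      exact hu (by simpa using hij)
    have hu' : (fun i => ((Equiv.ofBijective _ hbij) i).succ) = u := by
      funext i; simp
    rcases hw with hw | hw
    · refine ⟨(true, Equiv.ofBijective _ hbij), ?_⟩
      simp only [starEnum, if_true, hw]
      rw [hu']
      simp
    · refine ⟨(false, Equiv.ofBijective _ hbij), ?_⟩
      simp only [starEnum, hw]
      rw [hu']
      simp
  · rintro ⟨⟨b, σ⟩, rfl⟩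
    have := labeling_rep hk (fun i => (σ i).succ)
      (fun i j hij => σ.injective (by simpa using hij)) (fun i => Fin.succ_ne_zero _)
    cases b
    · simp only [starEnum, Set.mem_setOf_eq, Bool.false_eq_true, if_false, rep_reverse,
        List.length_reverse]
      exact this
    · simpa only [starEnum, Set.mem_setOf_eq, if_true] using this


/-- For `k ≥ 1`: the minimal length of a word-representant of the star
`S_k` is `2k`; there are exactly `2 · k!` word-representants of this minimal length; and
every such minimal-length word-representant has the form
`u_k u_1 ⋯ u_{k−1} c u_{k−1} ⋯ u_1` or `u_1 ⋯ u_{k−1} c u_{k−1} ⋯ u_1 u_k`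
for some labeling `u_1, …, u_k` of the leaves (`c = 0` being the center). -/
theorem star_min_reps (k : ℕ) (hk : 1 ≤ k) :
    minRepLength (starGraph k) = 2 * k ∧
    {w : List (Fin (k + 1)) | Represents (starGraph k) w ∧ w.length = 2 * k}.ncard =
      2 * Nat.factorial k ∧
    ∀ w : List (Fin (k + 1)), Represents (starGraph k) w → w.length = 2 * k →
      ∃ u : Fin k → Fin (k + 1), Function.Injective u ∧ (∀ i, u i ≠ 0) ∧
        (w = [u ⟨k - 1, by omega⟩] ++
              (List.ofFn fun i : Fin (k - 1) => u (Fin.castLE (by omega) i)) ++ [0] ++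
              (List.ofFn fun i : Fin (k - 1) => u (Fin.castLE (by omega) i)).reverse ∨
         w = (List.ofFn fun i : Fin (k - 1) => u (Fin.castLE (by omega) i)) ++ [0] ++
              (List.ofFn fun i : Fin (k - 1) => u (Fin.castLE (by omega) i)).reverse ++
              [u ⟨k - 1, by omega⟩]) := by
  refine ⟨?_, ?_, ?_⟩
  · have hr := labeling_rep hk Fin.succ (Fin.succ_injective k) Fin.succ_ne_zero
    apply le_antisymm
    · exact Nat.sInf_le ⟨_, hr⟩
    · refine le_csInf (Set.nonempty_of_mem (x := 2 * k) ⟨_, hr⟩) ?_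
      rintro n ⟨w, hw, rfl⟩
      exact (rep_lower w hw).1
  · rw [starEnum_range hk, ← Set.image_univ,
      Set.ncard_image_of_injective _ (starEnum_injective hk), Set.ncard_univ]
    simp [Nat.card_eq_fintype_card, Fintype.card_perm]
  · intro w h hl
    obtain ⟨u, hu, hu0, hw⟩ := rep_labeling hk w h hl
    refine ⟨u, hu, hu0, ?_⟩
    rcases hw with hw | hw
    · left; rw [hw]; simp [starWord, initList]
    · right; rw [hw]; simp [starWord, initList]
end

section
/- Let T = (V, E) be a tree on at least two vertices. Then the number n(T) of words of minimal length ℓ(T) that word-represent T equals 2 · (∏_{v ∈ V} deg(v)!) · (Σ_{xy ∈ E} 1/(deg(x) · deg(y))), where deg(v) denotes the degree of v in T. -/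
variable {V : Type*}

section Abstract

variable [DecidableEq V]

open Classical in
/-- Pairs of gaps whose parity vectors differ exactly in the letter `u`. -/
noncomputable def edgePairs (f : ℕ → V → ZMod 2) (L : ℕ) (u : V) :
    Finset (ℕ × ℕ) :=
  (Finset.range (L + 1) ×ˢ Finset.range (L + 1)).filter
    (fun p => p.1 < p.2 ∧ f p.1 + f p.2 = Pi.single u 1)

def liftPar (f : ℕ → V → ZMod 2) (v : V) (p q : ℕ) (k : ℕ) : V → ZMod 2 :=
  if k ≤ p then f k else if k ≤ q + 1 then f (k - 1) + Pi.single v 1 else f (k - 2)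

def InjPar (f : ℕ → V → ZMod 2) (L : ℕ) : Prop :=
  ∀ i j, i ≤ L → j ≤ L → f i = f j → i = j

def NonCross (f : ℕ → V → ZMod 2) (L : ℕ) : Prop :=
  ∀ i j k l a b, i < k → k < j → j < l → l ≤ L →
    f i + f j = Pi.single a 1 → f k + f l = Pi.single b 1 → False

/-- classification of new edges -/
lemma lift_cases (f : ℕ → V → ZMod 2) (v : V) (p q : ℕ) (hv : ∀ i, f i v = 0) (hpq : p < q)
    (L : ℕ) (hq : q ≤ L) (hinj : InjPar f L) (k l : ℕ) (hkl : k < l) (hl : l ≤ L + 2) (a : V)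
    (h : liftPar f v p q k + liftPar f v p q l = Pi.single a 1) :
    (a = v ∧ l = k + 1) ∨
    (a ≠ v ∧ p + 1 ≤ k ∧ l ≤ q + 1 ∧ f (k - 1) + f (l - 1) = Pi.single a 1) ∨
    (a ≠ v ∧ ∃ i j, i < j ∧ (i ≤ p ∨ q ≤ i) ∧ (j ≤ p ∨ q ≤ j) ∧
      k = (if i ≤ p then i else i + 2) ∧ l = (if j ≤ p then j else j + 2) ∧
      f i + f j = Pi.single a 1) := by
  have h2 : ∀ g : V → ZMod 2, g + g = 0 := fun g => by
    ext t; exact CharTwo.add_self_eq_zero _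
  have heq : ∀ g g' : V → ZMod 2, g + g' = 0 → g = g' := fun g g' hg => by
    have := congrArg (· + g') hg
    simpa [add_assoc, h2] using this
  have hs : ∀ g g' : V → ZMod 2, g v = 0 → g' v = 0 → g + g' = Pi.single a 1 → a ≠ v := by
    rintro g g' h1 h2 h3 rfl
    have := congrFun h3 a
    simp [h1, h2] at this
  have hs' : ∀ g g' : V → ZMod 2, g v = 0 → g' v = 0 → g + g' + Pi.single v 1 = Pi.single a 1 →
      a = v ∧ g = g' := by
    intro g g' h1 h2 h3
    have hav : a = v := by
      by_contra hne
      have := congrFun h3 v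
      simp [h1, h2, Ne.symm hne] at this
    refine ⟨hav, heq _ _ ?_⟩
    subst hav
    simpa using h3
  unfold liftPar at h
  by_cases k1 : k ≤ p
  · by_cases l1 : l ≤ p
    · rw [if_pos k1, if_pos l1] at h
      exact Or.inr (Or.inr ⟨hs _ _ (hv _) (hv _) h, k, l, hkl, by omega, by omega, by simp [k1],
        by simp [l1], h⟩)
    · by_cases l2 : l ≤ q + 1
      · rw [if_pos k1, if_neg l1, if_pos l2, ← add_assoc] at h
        obtain ⟨h3, h4⟩ := hs' _ _ (hv _) (hv _) h
        have := hinj _ _ (by omega) (by omega) h4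
        exact Or.inl ⟨h3, by omega⟩
      · rw [if_pos k1, if_neg l1, if_neg l2] at h
        refine Or.inr (Or.inr ⟨hs _ _ (hv _) (hv _) h, k, l - 2, ?_, by omega, by omega,
          by simp [k1], ?_, h⟩)
        · omega
        · rw [if_neg (by omega)]; omega
  · by_cases k2 : k ≤ q + 1
    · by_cases l2 : l ≤ q + 1
      · rw [if_neg k1, if_pos k2, if_neg (by omega), if_pos l2, add_add_add_comm, h2, add_zero] at h
        exact Or.inr (Or.inl ⟨hs _ _ (hv _) (hv _) h, by omega, by omega, h⟩)
      · rw [if_neg k1, if_pos k2, if_neg (by omega), if_neg l2, add_right_comm] at h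
        obtain ⟨h3, h4⟩ := hs' _ _ (hv _) (hv _) h
        have := hinj _ _ (by omega) (by omega) h4
        exact Or.inl ⟨h3, by omega⟩
    · rw [if_neg k1, if_neg k2, if_neg (by omega), if_neg (by omega)] at h
      refine Or.inr (Or.inr ⟨hs _ _ (hv _) (hv _) h, k - 2, l - 2, by omega, by omega, by omega,
          ?_, ?_, h⟩)
      · rw [if_neg (by omega)]; omega
      · rw [if_neg (by omega)]; omega

lemma lift_inj (f : ℕ → V → ZMod 2) (v : V) (p q : ℕ) (hv : ∀ i, f i v = 0) (hpq : p < q)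
    (L : ℕ) (hq : q ≤ L) (hinj : InjPar f L) : InjPar (liftPar f v p q) (L + 2) := by
  intro k l hk hl h
  have hb : ∀ g g' : V → ZMod 2, g v = 0 → g' v = 0 → g ≠ g' + Pi.single v 1 := by
    intro g g' h1 h2 h3
    have := congrFun h3 v
    simp [h1, h2] at this
  unfold liftPar at h
  split_ifs at h
  · exact hinj _ _ (by omega) (by omega) h
  · exact absurd h (hb _ _ (hv _) (hv _))
  · have := hinj _ _ (by omega) (by omega) h; omega
  · exact absurd h.symm (hb _ _ (hv _) (hv _))
  · have := hinj _ _ (by omega) (by omega) (add_right_cancel h); omega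
  · exact absurd h.symm (hb _ _ (hv _) (hv _))
  · have := hinj _ _ (by omega) (by omega) h; omega
  · exact absurd h (hb _ _ (hv _) (hv _))
  · have := hinj _ _ (by omega) (by omega) h; omega

lemma lift_noncross (f : ℕ → V → ZMod 2) (v : V) (p q : ℕ) (hv : ∀ i, f i v = 0) (hpq : p < q)
    (L : ℕ) (hq : q ≤ L) (hinj : InjPar f L) (hnc : NonCross f L) :
    NonCross (liftPar f v p q) (L + 2) := by
  intro i j k l a b hik hkj hjl hl h1 h2
  rcases lift_cases f v p q hv hpq L hq hinj i j (by omega) (by omega) a h1 with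
    ⟨-, h⟩ | ⟨-, h3, h4, h5⟩ | ⟨-, i', j', h3, h4, h5, h6, h7, h8⟩
  · omega
  · rcases lift_cases f v p q hv hpq L hq hinj k l (by omega) (by omega) b h2 with
      ⟨-, h⟩ | ⟨-, g3, g4, g5⟩ | ⟨-, k', l', g3, g4, g5, g6, g7, g8⟩
    · omega
    · exact hnc (i-1) (j-1) (k-1) (l-1) a b (by omega) (by omega) (by omega) (by omega) h5 g5
    · split_ifs at g6 <;> omega
  · rcases lift_cases f v p q hv hpq L hq hinj k l (by omega) (by omega) b h2 with
      ⟨-, h⟩ | ⟨-, g3, g4, g5⟩ | ⟨-, k', l', g3, g4, g5, g6, g7, g8⟩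
    · omega
    · split_ifs at h7 <;> omega
    · refine hnc i' j' k' l' a b ?_ ?_ ?_ ?_ h8 g8 <;> split_ifs at h6 h7 g6 g7 <;> omega

lemma lift_count_ne (f : ℕ → V → ZMod 2) (v : V) (p q : ℕ) (hv : ∀ i, f i v = 0) (hpq : p < q)
    (L : ℕ) (hq : q ≤ L) (hinj : InjPar f L) (hnc : NonCross f L) (u : V)
    (hu : f p + f q = Pi.single u 1) (z : V) (hz : z ≠ v) :
    (edgePairs (liftPar f v p q) (L + 2) z).card =
      (edgePairs f L z).card + if z = u then 1 else 0 := by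
  have h2 : ∀ g : V → ZMod 2, g + g = 0 := fun g => by
    ext t; exact CharTwo.add_self_eq_zero _
  let I := (edgePairs f L z).filter (fun r => p ≤ r.1 ∧ r.2 ≤ q)
  let O := (edgePairs f L z).filter (fun r => (r.1 ≤ p ∨ q ≤ r.1) ∧ (r.2 ≤ p ∨ q ≤ r.2))
  let s : ℕ → ℕ := fun i => if i ≤ p then i else i + 2
  have e1 : edgePairs (liftPar f v p q) (L + 2) z =
      I.image (fun r => (r.1 + 1, r.2 + 1)) ∪ O.image (fun r => (s r.1, s r.2)) := by
    ext ⟨k, l⟩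
    simp only [edgePairs, I, O, s, Finset.mem_filter, Finset.mem_product, Finset.mem_range,
      Finset.mem_union, Finset.mem_image, Prod.exists, Prod.mk.injEq]
    constructor
    · rintro ⟨⟨h3, h4⟩, h5, h6⟩
      rcases lift_cases f v p q hv hpq L hq hinj k l h5 (by omega) z h6 with
        ⟨h, -⟩ | ⟨-, h3, h4, h5⟩ | ⟨-, i', j', h3, h4, h5, h6, h7, h8⟩
      · exact absurd h hz
      · exact Or.inl ⟨k - 1, l - 1, ⟨⟨⟨by omega, by omega⟩, by omega, h5⟩, by omega, by omega⟩,
          by omega, by omega⟩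
      · refine Or.inr ⟨i', j', ⟨⟨⟨?_, ?_⟩, h3, h8⟩, h4, h5⟩, h6.symm, h7.symm⟩ <;>
        split_ifs at h6 h7 <;> omega
    · rintro (⟨i, j, ⟨⟨⟨h3, h4⟩, h5, h6⟩, h7, h8⟩, rfl, rfl⟩ |
        ⟨i, j, ⟨⟨⟨h3, h4⟩, h5, h6⟩, h7, h8⟩, rfl, rfl⟩)
      · refine ⟨⟨by omega, by omega⟩, by omega, ?_⟩
        unfold liftPar
        rw [if_neg (by omega), if_pos (by omega), if_neg (by omega), if_pos (by omega),
          add_add_add_comm, h2, add_zero]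
        exact h6
      · refine ⟨⟨by split_ifs <;> omega, by split_ifs <;> omega⟩, by split_ifs <;> omega, ?_⟩
        have : ∀ i, (i ≤ p ∨ q ≤ i) → liftPar f v p q (if i ≤ p then i else i + 2) = f i := by
          intro i hi
          unfold liftPar
          by_cases hip : i ≤ p
          · simp [hip]
          · rw [if_neg hip, if_neg (by omega), if_neg (by omega)]; rfl
        rw [this _ h7, this _ h8]; exact h6
  have d1 : Disjoint (I.image (fun r => (r.1 + 1, r.2 + 1))) (O.image (fun r => (s r.1, s r.2))) := by
    rw [Finset.disjoint_left]
    rintro ⟨k, l⟩ h3 h4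
    simp only [edgePairs, I, O, s, Finset.mem_filter, Finset.mem_product, Finset.mem_range,
      Finset.mem_image, Prod.exists, Prod.mk.injEq] at h3 h4
    obtain ⟨i, j, h, rfl, rfl⟩ := h3
    obtain ⟨i', j', h', h5, h6⟩ := h4
    split_ifs at h5 h6 <;> omega
  rw [e1, Finset.card_union_of_disjoint d1, Finset.card_image_of_injective,
    Finset.card_image_of_injective, ← Finset.card_union_add_card_inter]
  · congr 1
    · congr 1
      ext ⟨i, j⟩
      simp only [I, O, Finset.mem_union, Finset.mem_filter]
      constructor
      · rintro (h | h) <;> exact h.1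
      · intro h
        have h' := h
        simp only [edgePairs, Finset.mem_filter, Finset.mem_product, Finset.mem_range] at h'
        obtain ⟨⟨h3, h4⟩, h5, h6⟩ := h'
        by_contra hcon
        have hcon' : (i < p ∧ p < j ∧ j < q) ∨ (p < i ∧ i < q ∧ q < j) := by
          have c1 : ¬ (p ≤ i ∧ j ≤ q) := fun c => hcon (Or.inl ⟨h, c⟩)
          have c2 : ¬ ((i ≤ p ∨ q ≤ i) ∧ (j ≤ p ∨ q ≤ j)) := fun c => hcon (Or.inr ⟨h, c⟩)
          omega
        rcases hcon' with c | c
        · exact hnc i j p q z u (by omega) (by omega) (by omega) (by omega) h6 hu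
        · exact hnc p q i j u z (by omega) (by omega) (by omega) (by omega) hu h6
    · split_ifs with hzu
      · subst hzu
        rw [Finset.card_eq_one]
        refine ⟨(p, q), ?_⟩
        ext ⟨i, j⟩
        simp only [I, O, Finset.mem_inter, Finset.mem_filter, Finset.mem_singleton, Prod.mk.injEq,
          edgePairs, Finset.mem_product, Finset.mem_range]
        constructor
        · omega
        · rintro ⟨rfl, rfl⟩
          have : ((i < L + 1 ∧ j < L + 1) ∧ i < j ∧ f i + f j = Pi.single z 1) :=
            ⟨⟨by omega, by omega⟩, by omega, hu⟩
          exact ⟨⟨this, by omega, by omega⟩, this, by omega, by omega⟩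
      · rw [Finset.card_eq_zero, Finset.eq_empty_iff_forall_notMem]
        rintro ⟨i, j⟩ h
        simp only [I, O, Finset.mem_inter, Finset.mem_filter,
          edgePairs, Finset.mem_product, Finset.mem_range] at h
        obtain ⟨⟨⟨h3, h4, h5⟩, h6, h7⟩, -, h8, h9⟩ := h
        have hi : i = p := by omega
        have hj : j = q := by omega
        subst hi hj
        rw [hu] at h5
        have := congrFun h5 u
        simp [Ne.symm hzu] at this
  · rintro ⟨a, b⟩ ⟨c, d⟩ h
    simp only [s, Prod.mk.injEq] at h ⊢
    split_ifs at h <;> omega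
  · rintro ⟨a, b⟩ ⟨c, d⟩ h
    simp only [Prod.mk.injEq] at h ⊢
    omega

lemma lift_count_eq (f : ℕ → V → ZMod 2) (v : V) (p q : ℕ) (hv : ∀ i, f i v = 0) (hpq : p < q)
    (L : ℕ) (hq : q ≤ L) (hinj : InjPar f L) :
    (edgePairs (liftPar f v p q) (L + 2) v).card = 2 := by
  have h2 : ∀ g : V → ZMod 2, g + g = 0 := fun g => by
    ext t; exact CharTwo.add_self_eq_zero _
  have : edgePairs (liftPar f v p q) (L + 2) v = {(p, p+1), (q+1, q+2)} := by
    ext ⟨k, l⟩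
    simp only [edgePairs, Finset.mem_filter, Finset.mem_product, Finset.mem_range,
      Finset.mem_insert, Finset.mem_singleton, Prod.mk.injEq]
    constructor
    · rintro ⟨⟨h3, h4⟩, h5, h6⟩
      rcases lift_cases f v p q hv hpq L hq hinj k l h5 (by omega) v h6 with
        ⟨-, h⟩ | ⟨h, -⟩ | ⟨h, -⟩
      · subst h
        by_contra hcon
        have hvv := congrFun h6 v
        unfold liftPar at hvv
        split_ifs at hvv <;> first | omega | (simp [hv] at hvv)
      · exact absurd rfl h
      · exact absurd rfl h
    · rintro (⟨rfl, rfl⟩ | ⟨rfl, rfl⟩)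
      · refine ⟨⟨by omega, by omega⟩, by omega, ?_⟩
        unfold liftPar
        rw [if_pos (by omega), if_neg (by omega), if_pos (by omega), ← add_assoc]
        simp [h2]
      · refine ⟨⟨by omega, by omega⟩, by omega, ?_⟩
        unfold liftPar
        rw [if_neg (by omega), if_pos (by omega), if_neg (by omega), if_neg (by omega),
          add_right_comm]
        simp [h2]
  rw [this, Finset.card_pair]
  simp; omega

end Abstract

section Words

variable [DecidableEq V]

/-- parity vector of the prefix of length `i` -/
def parVec (w : List V) (i : ℕ) (z : V) : ZMod 2 := (List.count z (w.take i) : ZMod 2)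

lemma parVec_lift (A B C : List V) (v : V) (k : ℕ) :
    parVec (A ++ v :: (B ++ v :: C)) k =
      liftPar (parVec (A ++ B ++ C)) v A.length (A.length + B.length) k := by
  funext z
  unfold liftPar
  split_ifs with h1 h2
  · simp only [parVec, List.take_append, List.append_assoc]
    have : k - A.length = 0 := by omega
    simp [this]
  · obtain ⟨m, rfl⟩ : ∃ m, k = A.length + 1 + m := ⟨k - (A.length + 1), by omega⟩
    have e1 : A.length + 1 + m - A.length = m + 1 := by omega
    have e2 : A.length + 1 + m - 1 - A.length = m := by omega
    have e3 : m - B.length = 0 := by omega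
    have e4 : A.length + 1 + m - 1 = A.length + m := by omega
    simp only [parVec, List.take_append, List.append_assoc, e1, e2, List.take_succ_cons, e3,
      List.take_zero, List.append_nil, List.count_append, List.count_cons, Pi.add_apply]
    have : List.take (A.length + 1 + m) A = List.take (A.length + 1 + m - 1) A := by
      rw [List.take_of_length_le (by omega), List.take_of_length_le (by omega)]
    rw [this]
    by_cases hz : z = v
    · subst hz; simp; ring
    · simp [hz, Ne.symm hz]
  · obtain ⟨m, rfl⟩ : ∃ m, k = A.length + B.length + 2 + m :=
      ⟨k - (A.length + B.length + 2), by omega⟩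
    have e1 : A.length + B.length + 2 + m - A.length = B.length + 1 + m + 1 := by omega
    have e2 : A.length + B.length + 2 + m - 2 - A.length = B.length + m := by omega
    have e3 : B.length + 1 + m - B.length = m + 1 := by omega
    have e4 : B.length + m - B.length = m := by omega
    simp only [parVec, List.take_append, List.append_assoc, e1, e2, List.take_succ_cons, e3, e4,
      List.count_append, List.count_cons]
    rw [List.take_of_length_le (l := A) (by omega), List.take_of_length_le (l := A) (by omega),
      List.take_of_length_le (l := B) (by omega), List.take_of_length_le (l := B) (by omega)]
    by_cases hz : z = v
    · subst hz
      have : (2 : ZMod 2) = 0 := rfl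
      simp only [beq_self_eq_true, if_true]
      push_cast
      linear_combination this
    · simp [Ne.symm hz]

lemma alternates_comm (w : List V) (a b : V) : Alternates w a b ↔ Alternates w b a := by
  unfold Alternates restrictWord
  simp only [or_comm]

lemma restrict_free (A : List V) (v z : V) (hA : v ∉ A) :
    restrictWord A v z = List.replicate (A.count z) z := by
  unfold restrictWord
  rw [← List.filter_eq]
  apply List.filter_congr
  intro x hx
  have : x ≠ v := fun h => hA (h ▸ hx)
  simp [this]

lemma alternates_ins (A B C : List V) (v z : V) (hA : v ∉ A) (hB : v ∉ B) (hC : v ∉ C)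
    (hz : z ≠ v) (hc : (A ++ B ++ C).count z ≤ 2) :
    Alternates (A ++ v :: (B ++ v :: C)) v z ↔ B.count z = 1 := by
  have e : restrictWord (A ++ v :: (B ++ v :: C)) v z =
      List.replicate (A.count z) z ++ v :: (List.replicate (B.count z) z ++ v ::
        List.replicate (C.count z) z) := by
    rw [← restrict_free A v z hA, ← restrict_free B v z hB, ← restrict_free C v z hC]
    simp [restrictWord]
  unfold Alternates
  rw [e]
  simp only [List.count_append] at hc
  generalize A.count z = a at *
  generalize B.count z = b at *
  generalize C.count z = c at *
  have ha : a ≤ 2 := by omega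
  have hb : b ≤ 2 := by omega
  have hc' : c ≤ 2 := by omega
  unfold List.Chain'
  interval_cases a <;> interval_cases b <;> interval_cases c <;>
    first | omega | simp [List.replicate, hz, hz.symm]

lemma alternates_del (A B C : List V) (v a b : V) (ha : a ≠ v) (hb : b ≠ v) :
    Alternates (A ++ v :: (B ++ v :: C)) a b ↔ Alternates (A ++ B ++ C) a b := by
  simp [Alternates, restrictWord, ha.symm, hb.symm]

/-- `w` is a word on the letters `S` representing the induced graph on `S`, in which letters of `e`
occur once and other letters twice. -/
def Good (T : SimpleGraph V) (e : Sym2 V) (S : Finset V) (w : List V) : Prop :=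
  (∀ z, w.count z = if z ∈ S then (if z ∈ e then 1 else 2) else 0) ∧
  ∀ a ∈ S, ∀ b ∈ S, a ≠ b → (T.Adj a b ↔ Alternates w a b)

lemma Good.count_le {T : SimpleGraph V} {e : Sym2 V} {S : Finset V} {w : List V}
    (h : Good T e S w) (z : V) : w.count z ≤ 2 := by
  rw [h.1]; split_ifs <;> omega

lemma parVec_seg (A B C : List V) (z : V) :
    (parVec (A ++ B ++ C) A.length + parVec (A ++ B ++ C) (A.length + B.length)) z =
      (B.count z : ZMod 2) := by
  have h1 : (A ++ B ++ C).take A.length = A := by simp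
  have h2 : (A ++ B ++ C).take (A.length + B.length) = A ++ B := by
    exact List.take_left' (by simp)
  simp only [parVec, Pi.add_apply, h1, h2, List.count_append, Nat.cast_add, ← add_assoc,
    CharTwo.add_self_eq_zero, zero_add]

lemma cast_le_two (n : ℕ) (h : n ≤ 2) : ((n : ZMod 2) = 1 ↔ n = 1) ∧ ((n : ZMod 2) = 0 ↔ n ≠ 1) := by
  interval_cases n <;> decide

lemma good_insert_iff (T : SimpleGraph V) (e : Sym2 V) (S : Finset V) (u v : V) (hv : v ∉ S)
    (hve : v ∉ e) (hu : u ∈ S) (huv : ∀ z ∈ S, T.Adj v z ↔ z = u) (A B C : List V)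
    (hA : v ∉ A) (hB : v ∉ B) (hC : v ∉ C) :
    Good T e (insert v S) (A ++ v :: (B ++ v :: C)) ↔
      Good T e S (A ++ B ++ C) ∧
      parVec (A ++ B ++ C) A.length + parVec (A ++ B ++ C) (A.length + B.length) =
        Pi.single u 1 := by
  have cA := List.count_eq_zero_of_not_mem hA
  have cB := List.count_eq_zero_of_not_mem hB
  have cC := List.count_eq_zero_of_not_mem hC
  have hcount : ∀ z, z ≠ v → (A ++ v :: (B ++ v :: C)).count z = (A ++ B ++ C).count z := by
    intro z hz
    simp [List.count_append, List.count_cons, Ne.symm hz, add_assoc]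
  have key : ((∀ z, (A ++ v :: (B ++ v :: C)).count z =
        if z ∈ insert v S then (if z ∈ e then 1 else 2) else 0)) ↔
      (∀ z, (A ++ B ++ C).count z = if z ∈ S then (if z ∈ e then 1 else 2) else 0) := by
    constructor
    · intro h z
      by_cases hz : z = v
      · subst hz
        simp [hv, cA, cB, cC]
      · rw [← hcount z hz, h]; simp [hz]
    · intro h z
      by_cases hz : z = v
      · subst hz
        simp [hve, cA, cB, cC]
      · rw [hcount z hz, h]; simp [hz]
  unfold Good
  rw [key, and_assoc]
  refine and_congr_right fun hc => ?_
  have hle : ∀ z, (A ++ B ++ C).count z ≤ 2 := by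
    intro z; rw [hc]; split_ifs <;> omega
  have hBle : ∀ z, B.count z ≤ 2 := by
    intro z; have := hle z; simp only [List.count_append] at this; omega
  constructor
  · intro h
    constructor
    · intro a ha b hb hab
      rw [h a (by simp [ha]) b (by simp [hb]) hab, alternates_del]
      · rintro rfl; exact hv ha
      · rintro rfl; exact hv hb
    · funext z
      rw [parVec_seg]
      by_cases hzS : z ∈ S
      · have hzv : z ≠ v := by rintro rfl; exact hv hzS
        have := h v (by simp) z (by simp [hzS]) hzv.symm
        rw [huv z hzS, alternates_ins A B C v z hA hB hC hzv (hle z)] at this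
        by_cases hzu : z = u
        · subst hzu
          simp [this.1 rfl]
        · rw [Pi.single_eq_of_ne hzu, (cast_le_two _ (hBle z)).2]
          exact fun h => hzu (this.2 h)
      · have : B.count z = 0 := by
          have := hc z
          simp only [List.count_append, hzS, if_false] at this; omega
        have hzu : z ≠ u := by rintro rfl; exact hzS hu
        simp [this, hzu]
  · rintro ⟨h1, h2⟩
    have hvz : ∀ z ∈ S, (T.Adj v z ↔ Alternates (A ++ v :: (B ++ v :: C)) v z) := by
      intro z hzS
      have hzv : z ≠ v := by rintro rfl; exact hv hzS
      rw [huv z hzS, alternates_ins A B C v z hA hB hC hzv (hle z)]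
      have := congrFun h2 z
      rw [parVec_seg] at this
      by_cases hzu : z = u
      · subst hzu
        simp only [Pi.single_eq_same] at this
        simp [(cast_le_two _ (hBle z)).1.1 this]
      · rw [Pi.single_eq_of_ne hzu, (cast_le_two _ (hBle z)).2] at this
        simp [hzu, this]
    intro a ha b hb hab
    rw [Finset.mem_insert] at ha hb
    rcases ha with rfl | ha
    · rcases hb with rfl | hb
      · exact absurd rfl hab
      · exact hvz b hb
    · rcases hb with rfl | hb
      · rw [alternates_comm, ← hvz a ha, T.adj_comm]
      · rw [alternates_del, h1 a ha b hb hab]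
        · rintro rfl; exact hv ha
        · rintro rfl; exact hv hb

lemma decomp_two (w : List V) (v : V) (h : w.count v = 2) :
    ∃ A B C, w = A ++ v :: (B ++ v :: C) ∧ v ∉ A ∧ v ∉ B ∧ v ∉ C := by
  have h1 : v ∈ w := List.count_pos_iff.1 (by omega)
  obtain ⟨A, D, rfl, hA⟩ := List.append_of_mem h1 |>.elim fun _ _ => List.eq_append_cons_of_mem h1
  have hD : D.count v = 1 := by
    simp [List.count_append, List.count_eq_zero_of_not_mem hA] at h; exact h
  have h2 : v ∈ D := List.count_pos_iff.1 (by omega)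
  obtain ⟨B, C, rfl, hB⟩ := List.eq_append_cons_of_mem h2
  refine ⟨A, B, C, rfl, hA, hB, ?_⟩
  simp [List.count_append, List.count_eq_zero_of_not_mem hB] at hD
  exact List.count_eq_zero.1 hD

def insWord (v : V) (r : Σ _ : List V, ℕ × ℕ) : List V :=
  r.1.take r.2.1 ++ v :: ((r.1.take r.2.2).drop r.2.1 ++ v :: r.1.drop r.2.2)

/-- Splitting a word at two gaps. -/
lemma split_word (w : List V) (p q : ℕ) (hpq : p ≤ q) (hq : q ≤ w.length) :
    ∃ A B C, w = A ++ B ++ C ∧ p = A.length ∧ q = A.length + B.length := by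
  refine ⟨w.take p, (w.take q).drop p, w.drop q, ?_, ?_, ?_⟩
  · have : w.take p = (w.take q).take p := by rw [List.take_take, min_eq_left hpq]
    rw [this, List.take_append_drop, List.take_append_drop]
  · simp; omega
  · simp; omega

lemma insWord_split (v : V) (A B C : List V) :
    insWord v ⟨A ++ B ++ C, (A.length, A.length + B.length)⟩ = A ++ v :: (B ++ v :: C) := by
  have h1 : (A ++ B ++ C).take A.length = A := by simp
  have h2 : (A ++ B ++ C).take (A.length + B.length) = A ++ B := by
    exact List.take_left' (by simp)
  have h3 : (A ++ B ++ C).drop (A.length + B.length) = C := by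
    rw [← List.length_append]; simp
  simp only [insWord, h1, h2, h3]
  simp

lemma cons_inj_free {A A' D D' : List V} {v : V} (hA : v ∉ A) (hA' : v ∉ A')
    (h : A ++ v :: D = A' ++ v :: D') : A = A' ∧ D = D' := by
  induction A generalizing A' with
  | nil =>
    cases A' with
    | nil => simpa using h
    | cons a A' => simp at h hA'; exact absurd h.1 hA'.1
  | cons a A ih =>
    cases A' with
    | nil => simp at h hA; exact absurd h.1.symm hA.1
    | cons a' A' =>
      simp at h hA hA'
      obtain ⟨h1, h2⟩ := ih hA.2 hA'.2 h.2
      simp [h.1, h1, h2]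

end Words

section Induction

variable [DecidableEq V]

def degIn (T : SimpleGraph V) [DecidableRel T.Adj] (S : Finset V) (z : V) : ℕ :=
  (S.filter (T.Adj z)).card

def gIn (T : SimpleGraph V) [DecidableRel T.Adj] (e : Sym2 V) (S : Finset V) (z : V) : ℕ :=
  if z ∈ e then (degIn T S z - 1).factorial else (degIn T S z).factorial

def cIn (T : SimpleGraph V) [DecidableRel T.Adj] (e : Sym2 V) (S : Finset V) (z : V) : ℕ :=
  if z ∈ e then degIn T S z else degIn T S z + 1

structure WInv (T : SimpleGraph V) [DecidableRel T.Adj] (e : Sym2 V) (S : Finset V) : Prop where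
  sub : ∀ z ∈ e, z ∈ S
  words : ∃ F : Finset (List V), (∀ w, w ∈ F ↔ Good T e S w) ∧ F.card = 2 * ∏ z ∈ S, gIn T e S z
  inj : ∀ w, Good T e S w → InjPar (parVec w) w.length
  nc : ∀ w, Good T e S w → NonCross (parVec w) w.length
  cnt : ∀ w, Good T e S w → ∀ z ∈ S, (edgePairs (parVec w) w.length z).card = cIn T e S z
  deg_pos : ∀ z ∈ S, 1 ≤ degIn T S z

lemma degIn_insert (T : SimpleGraph V) [DecidableRel T.Adj] (S : Finset V) (u v : V) (hv : v ∉ S)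
    (huv : ∀ z ∈ S, T.Adj v z ↔ z = u) (z : V) (hz : z ∈ S) :
    degIn T (insert v S) z = degIn T S z + if z = u then 1 else 0 := by
  unfold degIn
  rw [Finset.filter_insert]
  have := huv z hz
  rw [T.adj_comm] at this
  by_cases h : z = u
  · rw [if_pos (this.2 h), if_pos h, Finset.card_insert_of_notMem]
    simp [hv]
  · rw [if_neg (fun h' => h (this.1 h')), if_neg h]; rfl

lemma degIn_insert_self (T : SimpleGraph V) [DecidableRel T.Adj] (S : Finset V) (u v : V)
    (hu : u ∈ S) (huv : ∀ z ∈ S, T.Adj v z ↔ z = u) : degIn T (insert v S) v = 1 := by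
  unfold degIn
  rw [Finset.card_eq_one]
  refine ⟨u, ?_⟩
  ext z
  simp only [Finset.mem_filter, Finset.mem_insert, Finset.mem_singleton]
  constructor
  · rintro ⟨rfl | h, h2⟩
    · exact absurd h2 (T.loopless.irrefl _)
    · exact (huv z h).1 h2
  · rintro rfl
    exact ⟨Or.inr hu, (huv z hu).2 rfl⟩

lemma Good.notMem {T : SimpleGraph V} {e : Sym2 V} {S : Finset V} {w : List V}
    (h : Good T e S w) {v : V} (hv : v ∉ S) : v ∉ w := by
  have := h.1 v
  rw [if_neg hv] at this
  exact List.count_eq_zero.1 this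

lemma parVec_eq_zero {w : List V} {v : V} (hv : v ∉ w) (i : ℕ) : parVec w i v = 0 := by
  unfold parVec
  rw [List.count_eq_zero_of_not_mem (fun h => hv (List.mem_of_mem_take h))]
  rfl

lemma mem_edgePairs (f : ℕ → V → ZMod 2) (L : ℕ) (u : V) (p q : ℕ) :
    (p, q) ∈ edgePairs f L u ↔ p < q ∧ q ≤ L ∧ f p + f q = Pi.single u 1 := by
  unfold edgePairs
  simp only [Finset.mem_filter, Finset.mem_product, Finset.mem_range]
  constructor
  · rintro ⟨⟨h1, h2⟩, h3, h4⟩; exact ⟨h3, by omega, h4⟩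
  · rintro ⟨h1, h2, h3⟩; exact ⟨⟨by omega, by omega⟩, h1, h3⟩

/-- every good word on `insert v S` is an insertion into a good word on `S` -/
lemma good_insert_cases (T : SimpleGraph V) (e : Sym2 V) (S : Finset V) (u v : V) (hv : v ∉ S)
    (hve : v ∉ e) (hu : u ∈ S) (huv : ∀ z ∈ S, T.Adj v z ↔ z = u) (w : List V)
    (hw : Good T e (insert v S) w) :
    ∃ A B C, w = A ++ v :: (B ++ v :: C) ∧ v ∉ A ∧ v ∉ B ∧ v ∉ C ∧ Good T e S (A ++ B ++ C) ∧
      (A.length, A.length + B.length) ∈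
        edgePairs (parVec (A ++ B ++ C)) (A ++ B ++ C).length u := by
  have h2 := hw.1 v
  simp only [Finset.mem_insert_self, if_true, hve, if_false] at h2
  obtain ⟨A, B, C, rfl, hA, hB, hC⟩ := decomp_two w v h2
  obtain ⟨h3, h4⟩ := (good_insert_iff T e S u v hv hve hu huv A B C hA hB hC).1 hw
  refine ⟨A, B, C, rfl, hA, hB, hC, h3, ?_⟩
  rw [mem_edgePairs]
  refine ⟨?_, ?_, h4⟩
  · rcases Nat.eq_zero_or_pos B.length with h | h
    · exfalso
      rw [h, add_zero] at h4
      have := congrFun h4 u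
      simp [CharTwo.add_self_eq_zero] at this
    · omega
  · simp only [List.length_append]; omega

lemma inv_step (T : SimpleGraph V) [DecidableRel T.Adj] (e : Sym2 V) (S : Finset V) (u v : V)
    (hv : v ∉ S) (hu : u ∈ S) (huv : ∀ z ∈ S, T.Adj v z ↔ z = u) (hI : WInv T e S) :
    WInv T e (insert v S) := by
  have hve : v ∉ e := fun h => hv (hI.sub v h)
  have hvu : u ≠ v := by rintro rfl; exact hv hu
  have hstr : ∀ w, Good T e (insert v S) w → ∃ w' p q, Good T e S w' ∧ p < q ∧ q ≤ w'.length ∧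
      parVec w' p + parVec w' q = Pi.single u 1 ∧ (∀ i, parVec w' i v = 0) ∧
      parVec w = liftPar (parVec w') v p q ∧ w.length = w'.length + 2 := by
    intro w hw
    obtain ⟨A, B, C, rfl, hA, hB, hC, h1, h2⟩ := good_insert_cases T e S u v hv hve hu huv w hw
    rw [mem_edgePairs] at h2
    refine ⟨A ++ B ++ C, A.length, A.length + B.length, h1, h2.1, h2.2.1, h2.2.2,
      parVec_eq_zero (h1.notMem hv), ?_, ?_⟩
    · funext k; exact parVec_lift A B C v k
    · simp only [List.length_append, List.length_cons]; omega
  refine ⟨?_, ?_, ?_, ?_, ?_, ?_⟩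
  · intro z hz
    exact Finset.mem_insert_of_mem (hI.sub z hz)
  · obtain ⟨F, hF, hcard⟩ := hI.words
    refine ⟨(F.sigma (fun w => edgePairs (parVec w) w.length u)).image (insWord v), ?_, ?_⟩
    · intro w
      rw [Finset.mem_image]
      constructor
      · rintro ⟨⟨w', p, q⟩, h1, rfl⟩
        rw [Finset.mem_sigma, hF] at h1
        obtain ⟨h1, h2⟩ := h1
        dsimp only at h1 h2
        rw [mem_edgePairs] at h2
        obtain ⟨A, B, C, rfl, rfl, rfl⟩ := split_word w' p q h2.1.le h2.2.1
        rw [insWord_split]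
        have hn := h1.notMem hv
        simp only [List.mem_append, not_or] at hn
        exact (good_insert_iff T e S u v hv hve hu huv A B C hn.1.1 hn.1.2 hn.2).2 ⟨h1, h2.2.2⟩
      · intro hw
        obtain ⟨A, B, C, rfl, hA, hB, hC, h1, h2⟩ := good_insert_cases T e S u v hv hve hu huv w hw
        refine ⟨⟨A ++ B ++ C, (A.length, A.length + B.length)⟩, ?_, insWord_split v A B C⟩
        rw [Finset.mem_sigma, hF]
        exact ⟨h1, h2⟩
    · rw [Finset.card_image_of_injOn]
      · rw [Finset.card_sigma, Finset.sum_congr rfl (fun w hw => hI.cnt w ((hF w).1 hw) u hu),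
          Finset.sum_const, hcard, smul_eq_mul, mul_assoc, Finset.prod_insert hv]
        congr 1
        have h1 : gIn T e (insert v S) v = 1 := by
          unfold gIn
          rw [if_neg hve, degIn_insert_self T S u v hu huv]; rfl
        rw [h1, one_mul, ← Finset.mul_prod_erase S _ hu, ← Finset.mul_prod_erase S _ hu]
        have h2 : ∀ z ∈ S.erase u, gIn T e (insert v S) z = gIn T e S z := by
          intro z hz
          rw [Finset.mem_erase] at hz
          unfold gIn
          rw [degIn_insert T S u v hv huv z hz.2, if_neg hz.1, add_zero]
        rw [Finset.prod_congr rfl h2]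
        have h3 : gIn T e (insert v S) u = gIn T e S u * cIn T e S u := by
          unfold gIn cIn
          rw [degIn_insert T S u v hv huv u hu, if_pos rfl]
          obtain ⟨d, hd⟩ : ∃ d, degIn T S u = d + 1 := ⟨_, (Nat.sub_add_cancel (hI.deg_pos u hu)).symm⟩
          rw [hd]
          split_ifs
          · simp [Nat.factorial_succ, mul_comm]
          · rw [Nat.factorial_succ (d + 1), mul_comm]
        rw [h3]; ring
      · rintro ⟨w', p, q⟩ h1 ⟨w'', p', q'⟩ h1' heq
        rw [Finset.mem_coe, Finset.mem_sigma, hF] at h1 h1'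
        obtain ⟨h1, h2⟩ := h1
        obtain ⟨h1', h2'⟩ := h1'
        dsimp only at h1 h2 h1' h2'
        rw [mem_edgePairs] at h2 h2'
        obtain ⟨A, B, C, rfl, rfl, rfl⟩ := split_word w' p q h2.1.le h2.2.1
        obtain ⟨A', B', C', rfl, rfl, rfl⟩ := split_word w'' p' q' h2'.1.le h2'.2.1
        rw [insWord_split, insWord_split] at heq
        have hn := h1.notMem hv
        have hn' := h1'.notMem hv
        simp only [List.mem_append, not_or] at hn hn'
        obtain ⟨rfl, h5⟩ := cons_inj_free hn.1.1 hn'.1.1 heq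
        obtain ⟨rfl, rfl⟩ := cons_inj_free hn.1.2 hn'.1.2 h5
        rfl
  · intro w hw
    obtain ⟨w', p, q, h1, h2, h3, h4, h5, h6, h7⟩ := hstr w hw
    rw [h6, h7]
    exact lift_inj _ v p q h5 h2 _ h3 (hI.inj w' h1)
  · intro w hw
    obtain ⟨w', p, q, h1, h2, h3, h4, h5, h6, h7⟩ := hstr w hw
    rw [h6, h7]
    exact lift_noncross _ v p q h5 h2 _ h3 (hI.inj w' h1) (hI.nc w' h1)
  · intro w hw z hz
    obtain ⟨w', p, q, h1, h2, h3, h4, h5, h6, h7⟩ := hstr w hw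
    rw [h6, h7]
    by_cases hzv : z = v
    · subst hzv
      rw [lift_count_eq _ z p q h5 h2 _ h3 (hI.inj w' h1)]
      unfold cIn
      rw [if_neg hve, degIn_insert_self T S u z hu huv]
    · have hzS : z ∈ S := by
        rw [Finset.mem_insert] at hz; exact hz.resolve_left hzv
      rw [lift_count_ne _ v p q h5 h2 _ h3 (hI.inj w' h1) (hI.nc w' h1) u h4 z hzv,
        hI.cnt w' h1 z hzS]
      unfold cIn
      rw [degIn_insert T S u v hv huv z hzS]
      split_ifs <;> omega
  · intro z hz
    by_cases hzv : z = v
    · subst hzv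
      rw [degIn_insert_self T S u z hu huv]
    · have hzS : z ∈ S := by
        rw [Finset.mem_insert] at hz; exact hz.resolve_left hzv
      rw [degIn_insert T S u v hv huv z hzS]
      have := hI.deg_pos z hzS
      omega

lemma pair_word (x y : V) (hxy : x ≠ y) (w : List V) (hx : w.count x = 1) (hy : w.count y = 1)
    (ho : ∀ z, z ≠ x → z ≠ y → w.count z = 0) : w = [x, y] ∨ w = [y, x] := by
  have hp : w.Perm [x, y] := by
    rw [List.perm_iff_count]
    intro z
    by_cases h1 : z = x
    · subst h1; simp [hx, hxy.symm]
    · by_cases h2 : z = y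
      · subst h2; simp [hy, hxy]
      · simp [ho z h1 h2, Ne.symm h1, Ne.symm h2]
  have hl := hp.length_eq
  match w, hl with
  | [a, b], _ =>
    have ha : a ∈ [x, y] := hp.subset (by simp)
    have hb : b ∈ [x, y] := hp.subset (by simp)
    simp only [List.mem_cons, List.not_mem_nil, or_false] at ha hb
    rcases ha with rfl | rfl <;> rcases hb with rfl | rfl <;> simp_all

lemma base_facts (x y : V) (hxy : x ≠ y) :
    InjPar (parVec [x, y]) 2 ∧ (edgePairs (parVec [x, y]) 2 x).card = 1 ∧
      (edgePairs (parVec [x, y]) 2 y).card = 1 := by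
  have f0 : parVec [x, y] 0 = 0 := by funext z; simp [parVec]
  have f1 : parVec [x, y] 1 = Pi.single x 1 := by
    funext z
    by_cases h1 : z = x
    · subst h1; simp [parVec]
    · simp [parVec, h1, Ne.symm h1]
  have f2 : parVec [x, y] 2 = Pi.single x 1 + Pi.single y 1 := by
    funext z
    by_cases h1 : z = x
    · subst h1; simp [parVec, hxy, hxy.symm]
    · by_cases h2 : z = y
      · subst h2; simp [parVec, hxy, hxy.symm]
      · simp [parVec, h1, h2, Ne.symm h1, Ne.symm h2]
  have n1 : ∀ a : V, (Pi.single a 1 : V → ZMod 2) ≠ 0 := by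
    intro a h; have := congrFun h a; simp at this
  have n2 : (Pi.single x 1 : V → ZMod 2) ≠ Pi.single y 1 := by
    intro h; have := congrFun h x; simp [hxy] at this
  have n3 : (Pi.single x 1 + Pi.single y 1 : V → ZMod 2) ≠ 0 := by
    intro h; have := congrFun h x; simp [hxy] at this
  have h2 : ∀ g : V → ZMod 2, g + g = 0 := fun g => by
    ext t; exact CharTwo.add_self_eq_zero _
  refine ⟨?_, ?_, ?_⟩
  · intro i j hi hj h
    interval_cases i <;> interval_cases j <;> simp_all [Ne.symm]
  · rw [Finset.card_eq_one]
    refine ⟨(0, 1), ?_⟩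
    ext ⟨i, j⟩
    rw [mem_edgePairs, Finset.mem_singleton, Prod.mk.injEq]
    constructor
    · rintro ⟨h3, h4, h5⟩
      interval_cases j <;> interval_cases i
      · simp
      · rw [f0, f2] at h5; simp at h5
      · rw [f1, f2, ← add_assoc, h2, zero_add] at h5; exact absurd h5.symm n2
    · rintro ⟨rfl, rfl⟩
      simp [f0, f1]
  · rw [Finset.card_eq_one]
    refine ⟨(1, 2), ?_⟩
    ext ⟨i, j⟩
    rw [mem_edgePairs, Finset.mem_singleton, Prod.mk.injEq]
    constructor
    · rintro ⟨h3, h4, h5⟩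
      interval_cases j <;> interval_cases i
      · rw [f0, f1, zero_add] at h5; exact absurd h5 n2
      · rw [f0, f2] at h5; simp at h5
      · simp
    · rintro ⟨rfl, rfl⟩
      rw [f1, f2, ← add_assoc, h2]; simp

lemma inv_base (T : SimpleGraph V) [DecidableRel T.Adj] (x y : V) (hxy : T.Adj x y) :
    WInv T s(x, y) {x, y} := by
  have hne : x ≠ y := hxy.ne
  have hne' : y ≠ x := hne.symm
  have hd : ∀ z ∈ ({x, y} : Finset V), degIn T {x, y} z = 1 := by
    intro z hz
    unfold degIn
    rw [Finset.card_eq_one]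
    simp only [Finset.mem_insert, Finset.mem_singleton] at hz
    rcases hz with rfl | rfl
    · exact ⟨y, by ext t; simp only [Finset.mem_filter, Finset.mem_insert, Finset.mem_singleton]
                   constructor
                   · rintro ⟨rfl | rfl, h⟩
                     · exact absurd rfl h.ne
                     · rfl
                   · rintro rfl; exact ⟨Or.inr rfl, hxy⟩⟩
    · exact ⟨x, by ext t; simp only [Finset.mem_filter, Finset.mem_insert, Finset.mem_singleton]
                   constructor
                   · rintro ⟨rfl | rfl, h⟩
                     · rfl
                     · exact absurd rfl h.ne
                   · rintro rfl; exact ⟨Or.inl rfl, hxy.symm⟩⟩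
  have hgood : ∀ w, Good T s(x, y) {x, y} w ↔ w = [x, y] ∨ w = [y, x] := by
    intro w
    constructor
    · intro h
      refine pair_word x y hne w ?_ ?_ ?_
      · rw [h.1]; simp
      · rw [h.1]; simp
      · intro z h1 h2; rw [h.1]; simp [h1, h2]
    · rintro (rfl | rfl)
      · constructor
        · intro z
          by_cases h1 : z = x
          · subst h1; simp [hne.symm]
          · by_cases h2 : z = y
            · subst h2; simp [hne]
            · simp [h1, h2, Ne.symm h1, Ne.symm h2]
        · intro a ha b hb hab
          simp only [Finset.mem_insert, Finset.mem_singleton] at ha hb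
          rcases ha with rfl | rfl <;> rcases hb with rfl | rfl <;>
            simp_all [Alternates, restrictWord, List.Chain', T.adj_comm]
      · constructor
        · intro z
          by_cases h1 : z = x
          · subst h1; simp [hne.symm]
          · by_cases h2 : z = y
            · subst h2; simp [hne]
            · simp [h1, h2, Ne.symm h1, Ne.symm h2]
        · intro a ha b hb hab
          simp only [Finset.mem_insert, Finset.mem_singleton] at ha hb
          rcases ha with rfl | rfl <;> rcases hb with rfl | rfl <;>
            simp_all [Alternates, restrictWord, List.Chain', T.adj_comm]
  refine ⟨?_, ?_, ?_, ?_, ?_, ?_⟩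
  · intro z hz
    simpa using hz
  · refine ⟨{[x, y], [y, x]}, ?_, ?_⟩
    · intro w; rw [hgood]; simp
    · rw [Finset.card_pair (by simp [hne]), Finset.prod_eq_one, mul_one]
      intro z hz
      unfold gIn
      rw [hd z hz]
      split_ifs <;> rfl
  · intro w hw
    rcases (hgood w).1 hw with rfl | rfl
    · exact (base_facts x y hne).1
    · exact (base_facts y x hne.symm).1
  · intro w hw i j k l a b h1 h2 h3 h4
    have : w.length = 2 := by rcases (hgood w).1 hw with rfl | rfl <;> rfl
    omega
  · intro w hw z hz
    have hc : cIn T s(x, y) {x, y} z = 1 := by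
      unfold cIn
      rw [if_pos (by simpa using hz), hd z hz]
    rw [hc]
    simp only [Finset.mem_insert, Finset.mem_singleton] at hz
    have b1 := base_facts x y hne
    have b2 := base_facts y x hne.symm
    rcases (hgood w).1 hw with rfl | rfl <;> rcases hz with rfl | rfl
    · exact b1.2.1
    · exact b1.2.2
    · exact b2.2.2
    · exact b2.2.1
  · intro z hz
    rw [hd z hz]

end Induction

section Final

variable [DecidableEq V]

lemma inv_univ [Fintype V] (T : SimpleGraph V) [DecidableRel T.Adj] (hT : T.IsTree) (x y : V)
    (hxy : T.Adj x y) : WInv T s(x, y) Finset.univ := by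
  let Q : Finset V → Prop := fun S => WInv T s(x, y) S ∧
    ∀ a ∈ S, ∀ b ∈ S, ∃ p : T.Walk a b, ∀ t ∈ p.support, t ∈ S
  have hbase : Q {x, y} := by
    refine ⟨inv_base T x y hxy, ?_⟩
    intro a ha b hb
    simp only [Finset.mem_insert, Finset.mem_singleton] at ha hb
    rcases ha with rfl | rfl <;> rcases hb with rfl | rfl
    · exact ⟨.nil, by simp⟩
    · exact ⟨.cons hxy .nil, by simp⟩
    · exact ⟨.cons hxy.symm .nil, by simp⟩
    · exact ⟨.nil, by simp⟩
  have hstep : ∀ S, Q S → S ≠ Finset.univ → ∃ v, v ∉ S ∧ Q (insert v S) := by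
    rintro S ⟨hI, hC⟩ hS
    obtain ⟨t, ht⟩ : ∃ t, t ∉ S := by
      by_contra h; push Not at h; exact hS (Finset.eq_univ_iff_forall.2 h)
    have hxS : x ∈ S := hI.sub x (by simp)
    obtain ⟨p⟩ := hT.connected.preconnected x t
    obtain ⟨d, -, h1, h2⟩ := p.exists_boundary_dart (S : Set V) (by simpa using hxS) (by simpa using ht)
    rw [Finset.mem_coe] at h1 h2
    obtain ⟨⟨u, v⟩, huv⟩ := d
    dsimp only at h1 h2 huv
    have huniq : ∀ z ∈ S, T.Adj v z ↔ z = u := by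
      intro z hz
      constructor
      · intro hvz
        by_contra hne
        obtain ⟨r, hr⟩ := hC u h1 z hz
        let r1 : T.Path u z := r.toPath
        have hp : (SimpleGraph.Walk.cons huv (.cons hvz .nil)).IsPath := by
          rw [SimpleGraph.Walk.isPath_def]
          simp [huv.ne, hvz.ne, Ne.symm hne]
        let r2 : T.Path u z := ⟨_, hp⟩
        have hsub := hT.isAcyclic.subsingleton_path u z
        have h12 : r1 = r2 := Subsingleton.elim _ _
        have hmem : v ∈ (r1 : T.Walk u z).support := by
          rw [h12]; simp [r2]
        exact h2 (hr v (SimpleGraph.Walk.support_bypass_subset _ hmem))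
      · rintro rfl; exact huv.symm
    refine ⟨v, h2, inv_step T _ S u v h2 h1 huniq hI, ?_⟩
    intro a ha b hb
    rw [Finset.mem_insert] at ha hb
    rcases ha with rfl | ha <;> rcases hb with rfl | hb
    · exact ⟨.nil, by simp⟩
    · obtain ⟨r, hr⟩ := hC u h1 b hb
      refine ⟨.cons huv.symm r, ?_⟩
      intro t ht
      rw [SimpleGraph.Walk.support_cons, List.mem_cons] at ht
      rw [Finset.mem_insert]
      exact ht.imp id (hr t)
    · obtain ⟨r, hr⟩ := hC u h1 a ha
      refine ⟨(SimpleGraph.Walk.cons huv.symm r).reverse, ?_⟩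
      intro t ht
      rw [SimpleGraph.Walk.support_reverse, List.mem_reverse, SimpleGraph.Walk.support_cons,
        List.mem_cons] at ht
      rw [Finset.mem_insert]
      exact ht.imp id (hr t)
    · obtain ⟨r, hr⟩ := hC a ha b hb
      exact ⟨r, fun t ht => Finset.mem_insert_of_mem (hr t ht)⟩
  classical
  obtain ⟨S, hS, hmax⟩ := Finset.exists_max_image (Finset.univ.filter Q) Finset.card
    ⟨{x, y}, by simp [hbase]⟩
  rw [Finset.mem_filter] at hS
  by_cases h : S = Finset.univ
  · rw [← h]; exact hS.2.1
  · obtain ⟨v, hv, hQ⟩ := hstep S hS.2 h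
    have := hmax (insert v S) (by simp [hQ])
    rw [Finset.card_insert_of_notMem hv] at this
    omega

lemma once_alternates (w : List V) (a b : V) (hab : a ≠ b) (ha : w.count a = 1)
    (hb : w.count b = 1) : Alternates w a b := by
  have h : ∀ z, (restrictWord w a b).count z = if z = a ∨ z = b then w.count z else 0 := by
    intro z
    unfold restrictWord
    split_ifs with h
    · exact List.count_filter (by simpa using h)
    · rw [List.count_eq_zero]
      intro hm
      exact h (by simpa using (List.mem_filter.1 hm).2)
  have := pair_word a b hab (restrictWord w a b) (by rw [h]; simp [ha]) (by rw [h]; simp [hb])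
    (fun z h1 h2 => by rw [h]; simp [h1, h2])
  unfold Alternates List.Chain'
  rcases this with h | h <;> rw [h] <;> simp [hab, hab.symm]

lemma sum_count [Fintype V] (w : List V) : ∑ v : V, w.count v = w.length := by
  have := Multiset.sum_count_eq_card (s := Finset.univ) (m := (w : Multiset V)) (by simp)
  simpa using this

lemma rep_struct_s7 [Fintype V] (T : SimpleGraph V) (hT : T.IsTree) (w : List V)
    (hw : Represents T w) : 2 * Fintype.card V - 2 ≤ w.length ∧
      (2 ≤ Fintype.card V → w.length = 2 * Fintype.card V - 2 →
        ∃ a b, T.Adj a b ∧ ∀ z, w.count z = if z ∈ s(a, b) then 1 else 2) := by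
  let O := Finset.univ.filter (fun v => w.count v = 1)
  have hadj : ∀ a ∈ O, ∀ b ∈ O, a ≠ b → T.Adj a b := by
    intro a ha b hb hab
    rw [hw.2 a b hab]
    exact once_alternates w a b hab (Finset.mem_filter.1 ha).2 (Finset.mem_filter.1 hb).2
  have hO : O.card ≤ 2 := by
    by_contra hcon
    obtain ⟨t, ht, htc⟩ := Finset.exists_subset_card_eq (show 3 ≤ O.card by omega)
    refine hT.isAcyclic.cliqueFree le_rfl t ⟨?_, htc⟩
    intro a ha b hb hab
    exact hadj a (ht ha) b (ht hb) hab
  have hpos : ∀ v, 1 ≤ w.count v := fun v => List.count_pos_iff.2 (hw.1 v)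
  have hge : ∀ v, (if v ∈ O then 1 else 2) ≤ w.count v := by
    intro v
    have := hpos v
    split_ifs with h
    · exact this
    · have : w.count v ≠ 1 := fun h' => h (by simp [O, h'])
      omega
  have hsum : ∑ v : V, (if v ∈ O then 1 else 2) + O.card = 2 * Fintype.card V := by
    have : O.card = ∑ v : V, (if v ∈ O then 1 else 0) := by simp
    rw [this, ← Finset.sum_add_distrib]
    have : ∀ v : V, (if v ∈ O then 1 else 2) + (if v ∈ O then 1 else 0) = 2 := by
      intro v; split_ifs <;> rfl
    simp [this, mul_comm]
  have hle := Finset.sum_le_sum (s := Finset.univ) (fun v _ => hge v)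
  rw [sum_count] at hle
  refine ⟨by omega, ?_⟩
  intro h2 hlen
  have hO2 : O.card = 2 := by omega
  have heq : ∑ v : V, (if v ∈ O then 1 else 2) = ∑ v : V, w.count v := by
    rw [sum_count]; omega
  have hall := (Finset.sum_eq_sum_iff_of_le (fun v _ => hge v)).1 heq
  obtain ⟨a, b, hab, hOab⟩ := Finset.card_eq_two.1 hO2
  refine ⟨a, b, hadj a (by simp [hOab]) b (by simp [hOab]) hab, ?_⟩
  intro z
  rw [← hall z (Finset.mem_univ z), hOab]
  simp

lemma good_univ_iff [Fintype V] (T : SimpleGraph V) (e : Sym2 V) (w : List V) :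
    Good T e Finset.univ w ↔ Represents T w ∧ ∀ z, w.count z = if z ∈ e then 1 else 2 := by
  unfold Good Represents
  simp only [Finset.mem_univ, if_true, true_imp_iff]
  constructor
  · rintro ⟨h1, h2⟩
    refine ⟨⟨fun v => List.count_pos_iff.1 ?_, h2⟩, h1⟩
    rw [h1]; split_ifs <;> omega
  · rintro ⟨⟨h1, h2⟩, h3⟩
    exact ⟨h3, h2⟩

lemma good_length [Fintype V] (T : SimpleGraph V) (x y : V) (hxy : x ≠ y) (w : List V)
    (h : Good T s(x, y) Finset.univ w) : w.length = 2 * Fintype.card V - 2 := by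
  rw [good_univ_iff] at h
  rw [← sum_count]
  have h1 : ∑ v : V, (w.count v + if v ∈ ({x, y} : Finset V) then 1 else 0) = 2 * Fintype.card V := by
    have : ∀ v : V, (w.count v + if v ∈ ({x, y} : Finset V) then 1 else 0) = 2 := by
      intro v
      rw [h.2 v]
      simp only [Sym2.mem_iff, Finset.mem_insert, Finset.mem_singleton]
      split_ifs <;> rfl
    rw [Finset.sum_congr rfl (fun v _ => this v)]
    simp [mul_comm]
  rw [Finset.sum_add_distrib] at h1
  have h2 : ∑ v : V, (if v ∈ ({x, y} : Finset V) then 1 else 0) = 2 := by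
    rw [Finset.sum_ite_mem, Finset.univ_inter, Finset.sum_const, Finset.card_pair hxy]; rfl
  omega

lemma weight_eq [Fintype V] (T : SimpleGraph V) [DecidableRel T.Adj] (x y : V) (hxy : T.Adj x y) :
    ((∏ z : V, gIn T s(x, y) Finset.univ z : ℕ) : ℚ) =
      (∏ v : V, ((T.degree v).factorial : ℚ)) *
        (1 / ((T.degree x : ℚ) * (T.degree y : ℚ))) := by
  have hd : ∀ z, degIn T Finset.univ z = T.degree z := by
    intro z
    unfold degIn
    rw [← SimpleGraph.card_neighborFinset_eq_degree]
    congr 1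
    ext t; simp
  have hx : T.degree x ≠ 0 := (Nat.pos_iff_ne_zero.1 (T.degree_pos_iff_exists_adj x |>.2 ⟨y, hxy⟩))
  have hy : T.degree y ≠ 0 :=
    (Nat.pos_iff_ne_zero.1 (T.degree_pos_iff_exists_adj y |>.2 ⟨x, hxy.symm⟩))
  have h1 : ∀ z, ((gIn T s(x, y) Finset.univ z : ℕ) : ℚ) =
      ((T.degree z).factorial : ℚ) *
        (if z ∈ ({x, y} : Finset V) then 1 / (T.degree z : ℚ) else 1) := by
    intro z
    unfold gIn
    rw [hd]
    by_cases hz : z ∈ s(x, y)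
    · have hz' : z ∈ ({x, y} : Finset V) := by simpa using hz
      rw [if_pos hz, if_pos hz']
      have h0 : T.degree z ≠ 0 := by
        rcases Sym2.mem_iff.1 hz with rfl | rfl <;> assumption
      obtain ⟨d, hd'⟩ := Nat.exists_eq_succ_of_ne_zero h0
      rw [hd', Nat.factorial_succ]
      have : ((d.succ : ℕ) : ℚ) ≠ 0 := by positivity
      simp only [Nat.succ_sub_one, Nat.succ_eq_add_one] at this ⊢
      push_cast at this ⊢
      field_simp
    · have hz' : z ∉ ({x, y} : Finset V) := by simpa using hz
      rw [if_neg hz, if_neg hz', mul_one]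
  push_cast
  rw [Finset.prod_congr rfl (fun z _ => h1 z), Finset.prod_mul_distrib, Finset.prod_ite_mem,
    Finset.univ_inter, Finset.prod_pair hxy.ne]
  congr 1
  rw [one_div_mul_one_div]

end Final

theorem tree_count_min_reps [Fintype V] [DecidableEq V]
    (T : SimpleGraph V) [DecidableRel T.Adj] (hT : T.IsTree) (h2 : 2 ≤ Fintype.card V) :
    ({w : List V | Represents T w ∧ w.length = minRepLength T}.ncard : ℚ) =
      2 * (∏ v : V, ((T.degree v).factorial : ℚ)) *
        ∑ e ∈ T.edgeFinset,
          Sym2.lift ⟨fun x y => (1 : ℚ) / ((T.degree x : ℚ) * (T.degree y : ℚ)),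
            fun a b => by simp [mul_comm]⟩ e := by
  classical
  have hall : ∀ e ∈ T.edgeFinset, ∃ F : Finset (List V), (∀ w, w ∈ F ↔ Good T e Finset.univ w) ∧
      (F.card : ℚ) = 2 * (∏ v : V, ((T.degree v).factorial : ℚ)) *
        Sym2.lift ⟨fun x y => (1 : ℚ) / ((T.degree x : ℚ) * (T.degree y : ℚ)),
            fun a b => by simp [mul_comm]⟩ e := by
    intro e
    induction e with
    | h x y =>
      intro he
      have hxy : T.Adj x y := by simpa using he
      obtain ⟨F, hF, hc⟩ := (inv_univ T hT x y hxy).words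
      refine ⟨F, hF, ?_⟩
      rw [hc, Nat.cast_mul, weight_eq T x y hxy, Sym2.lift_mk, Nat.cast_ofNat, mul_assoc]
  choose! F hF hcard using hall
  -- some edge exists
  obtain ⟨x, y, hxy⟩ : ∃ x y, T.Adj x y := by
    haveI : Nontrivial V := Fintype.one_lt_card_iff_nontrivial.1 h2
    obtain ⟨x⟩ := hT.connected.nonempty
    obtain ⟨y, hy⟩ := hT.connected.preconnected.exists_adj_of_nontrivial x
    exact ⟨x, y, hy⟩
  have hmin : minRepLength T = 2 * Fintype.card V - 2 := by
    obtain ⟨F', hF', hc'⟩ := (inv_univ T hT x y hxy).words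
    have hpos : 0 < F'.card := by
      rw [hc']
      refine Nat.mul_pos (by norm_num) (Finset.prod_pos fun z _ => ?_)
      unfold gIn
      split_ifs <;> exact Nat.factorial_pos _
    obtain ⟨w, hw⟩ := Finset.card_pos.1 hpos
    rw [hF'] at hw
    have hwl := good_length T x y hxy.ne w hw
    have hwr := ((good_univ_iff T _ w).1 hw).1
    apply le_antisymm
    · exact Nat.sInf_le ⟨w, hwr, hwl⟩
    · have hne : {n | ∃ w : List V, Represents T w ∧ w.length = n}.Nonempty := ⟨_, w, hwr, rfl⟩
      obtain ⟨w', h1, h2⟩ := Nat.sInf_mem hne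
      unfold minRepLength
      rw [← h2]
      exact (rep_struct_s7 T hT w' h1).1
  have hset : {w : List V | Represents T w ∧ w.length = minRepLength T} =
      ↑(T.edgeFinset.biUnion F) := by
    ext w
    rw [Set.mem_setOf_eq, hmin, Finset.mem_coe, Finset.mem_biUnion]
    constructor
    · rintro ⟨hr, hl⟩
      obtain ⟨a, b, hab, hc⟩ := (rep_struct_s7 T hT w hr).2 h2 hl
      have he : s(a, b) ∈ T.edgeFinset := by simpa using hab
      exact ⟨s(a, b), he, (hF _ he w).2 ((good_univ_iff T _ w).2 ⟨hr, hc⟩)⟩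
    · rintro ⟨e, he, hw⟩
      rw [hF e he] at hw
      refine ⟨((good_univ_iff T _ w).1 hw).1, ?_⟩
      induction e with
      | h a b =>
        have hab : T.Adj a b := by simpa using he
        exact good_length T a b hab.ne w hw
  have hdisj : (T.edgeFinset : Set (Sym2 V)).PairwiseDisjoint F := by
    intro e he e' he' hne
    rw [Function.onFun, Finset.disjoint_left]
    intro w h3 h4
    rw [hF e he, good_univ_iff] at h3
    rw [hF e' he', good_univ_iff] at h4
    apply hne
    apply Sym2.ext
    intro z
    have h5 := h3.2 z
    rw [h4.2 z] at h5
    by_cases c1 : z ∈ e <;> by_cases c2 : z ∈ e' <;> simp [c1, c2] at h5 ⊢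
  rw [hset, Set.ncard_coe_finset, Finset.card_biUnion hdisj, Nat.cast_sum,
    Finset.sum_congr rfl hcard, Finset.mul_sum]
end
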